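/- arXiv:2208.12351 — 6 statements merged into one kernel-verified Lean document; each statement's English description precedes it below -/
import Mathlib

section
/- For all ε > 0, α > 1 and z ∈ ℝ³, the vector field Ψ_{ε,α}[z] : ℝ³ → ℝ³ equals the constant vector z on {|x| ≤ ε}, vanishes on {|x| ≥ αε}, is smooth on the open annulus {ε < |x| < αε} where it coincides with curl(η_{ε,α} v_z), and its divergence vanishes at every point x with |x| ∉ {ε, αε}. -/
/-- The radial cut-off profile `f_{A,B}`. -/
noncomputable def fAB (A B : ℝ) (z : ℝ) : ℝ :=
  if z < A then 1
  else if z ≤ B then (Real.log z - Real.log B) / (Real.log A - Real.log B)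
  else 0

/-- The cut-off `η_{ε,α}(x) = f_{ε,αε}(|x|)` on `ℝ^d`. -/
noncomputable def eta (d : ℕ) (ε α : ℝ) (x : EuclideanSpace ℝ (Fin d)) : ℝ :=
  fAB ε (α * ε) ‖x‖

/-- The auxiliary field `v_z(x) = (z₂x₃, z₃x₁, z₁x₂)` (1-based indices). -/
noncomputable def vz (z x : EuclideanSpace ℝ (Fin 3)) : EuclideanSpace ℝ (Fin 3) :=
  (WithLp.equiv 2 (Fin 3 → ℝ)).symm ![z 1 * x 2, z 2 * x 0, z 0 * x 1]

/-- Cross product of two vectors of `ℝ³`. -/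
noncomputable def cross3 (a b : EuclideanSpace ℝ (Fin 3)) : EuclideanSpace ℝ (Fin 3) :=
  (WithLp.equiv 2 (Fin 3 → ℝ)).symm
    ![a 1 * b 2 - a 2 * b 1, a 2 * b 0 - a 0 * b 2, a 0 * b 1 - a 1 * b 0]

/-- The gradient `∇η_{ε,α}(x) = -x/(|x|² log α)` on the annulus. -/
noncomputable def gradEta3 (α : ℝ) (x : EuclideanSpace ℝ (Fin 3)) : EuclideanSpace ℝ (Fin 3) :=
  -(1 / (‖x‖ ^ 2 * Real.log α)) • x

/-- The divergence-free cut-off field `Ψ_{ε,α}[z]` in dimension 3: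
equal to `z` for `|x| ≤ ε`, to `η_{ε,α} z + ∇η_{ε,α} × v_z` for `ε < |x| < αε`,
and to `0` for `|x| ≥ αε`. -/
noncomputable def Psi3 (ε α : ℝ) (z x : EuclideanSpace ℝ (Fin 3)) : EuclideanSpace ℝ (Fin 3) :=
  if ‖x‖ ≤ ε then z
  else if ‖x‖ < α * ε then eta 3 ε α x • z + cross3 (gradEta3 α x) (vz z x)
  else 0

/-- Curl of a vector field on `ℝ³`, via Fréchet derivatives in coordinate directions. -/
noncomputable def curl3 (F : EuclideanSpace ℝ (Fin 3) → EuclideanSpace ℝ (Fin 3))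
    (x : EuclideanSpace ℝ (Fin 3)) : EuclideanSpace ℝ (Fin 3) :=
  (WithLp.equiv 2 (Fin 3 → ℝ)).symm
    ![fderiv ℝ F x (EuclideanSpace.single 1 1) 2 - fderiv ℝ F x (EuclideanSpace.single 2 1) 1,
      fderiv ℝ F x (EuclideanSpace.single 2 1) 0 - fderiv ℝ F x (EuclideanSpace.single 0 1) 2,
      fderiv ℝ F x (EuclideanSpace.single 0 1) 1 - fderiv ℝ F x (EuclideanSpace.single 1 1) 0]

/-- Divergence of a vector field on `ℝ³`. -/
noncomputable def div3 (F : EuclideanSpace ℝ (Fin 3) → EuclideanSpace ℝ (Fin 3))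
    (x : EuclideanSpace ℝ (Fin 3)) : ℝ :=
  ∑ i, fderiv ℝ F x (EuclideanSpace.single i 1) i

abbrev E3 := EuclideanSpace ℝ (Fin 3)

lemma ann_nhds (ε α : ℝ) (x : E3) (h1 : ε < ‖x‖) (h2 : ‖x‖ < α * ε) :
    ∀ᶠ y in nhds x, ε < ‖y‖ ∧ ‖y‖ < α * ε := by
  have c : ContinuousAt (fun y : E3 => ‖y‖) x := continuous_norm.continuousAt
  exact (c.eventually_const_lt h1).and (c.eventually_lt_const h2)

lemma eta_ann (ε α : ℝ) (hε : 0 < ε) (hα : 1 < α) (y : E3) (h1 : ε < ‖y‖) (h2 : ‖y‖ < α * ε) :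
    eta 3 ε α y = (Real.log (α * ε) - (1 / 2) * Real.log (‖y‖ ^ 2)) / Real.log α := by
  have hl : Real.log α ≠ 0 := (Real.log_pos hα).ne'
  unfold eta fAB
  rw [if_neg (not_lt.2 h1.le), if_pos h2.le, Real.log_mul (by positivity) hε.ne', Real.log_pow]
  have : Real.log ε - (Real.log α + Real.log ε) = - Real.log α := by ring
  rw [this]
  field_simp
  push_cast
  ring

lemma eta_smooth (ε α : ℝ) (hε : 0 < ε) (hα : 1 < α) (x : E3) (h1 : ε < ‖x‖)
    (h2 : ‖x‖ < α * ε) : ContDiffAt ℝ (⊤ : ℕ∞) (eta 3 ε α) x := by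
  have hx : ‖x‖ ^ 2 ≠ 0 := by have := hε.trans h1; positivity
  have : eta 3 ε α =ᶠ[nhds x]
      fun y => (Real.log (α * ε) - (1 / 2) * Real.log (‖y‖ ^ 2)) / Real.log α := by
    filter_upwards [ann_nhds ε α x h1 h2] with y hy using eta_ann ε α hε hα y hy.1 hy.2
  refine ContDiffAt.congr_of_eventuallyEq ?_ this
  have h : ContDiffAt ℝ (⊤ : ℕ∞) (fun y : E3 => ‖y‖ ^ 2) x := (contDiff_norm_sq ℝ).contDiffAt
  exact (contDiffAt_const.sub (contDiffAt_const.mul (h.log hx))).div_const _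

lemma coord_smooth (i : Fin 3) (x : E3) : ContDiffAt ℝ (⊤ : ℕ∞) (fun y : E3 => y i) x :=
  (EuclideanSpace.proj (𝕜 := ℝ) i : E3 →L[ℝ] ℝ).contDiff.contDiffAt

lemma vz_smooth (z x : E3) : ContDiffAt ℝ (⊤ : ℕ∞) (vz z) x := by
  rw [contDiffAt_euclidean]
  intro i
  fin_cases i <;> simp [vz] <;> exact contDiffAt_const.mul (coord_smooth _ _)

lemma cross_smooth (F G : E3 → E3) (x : E3) (hF : ContDiffAt ℝ (⊤ : ℕ∞) F x)
    (hG : ContDiffAt ℝ (⊤ : ℕ∞) G x) : ContDiffAt ℝ (⊤ : ℕ∞) (fun y => cross3 (F y) (G y)) x := by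
  rw [contDiffAt_euclidean] at hF hG ⊢
  intro i
  fin_cases i <;> simp [cross3] <;>
    exact ((hF _).mul (hG _)).sub ((hF _).mul (hG _))

lemma grad_smooth (α : ℝ) (hα : 1 < α) (x : E3) (hx : ‖x‖ ≠ 0) :
    ContDiffAt ℝ (⊤ : ℕ∞) (gradEta3 α) x := by
  have hl : Real.log α ≠ 0 := (Real.log_pos hα).ne'
  have h : ContDiffAt ℝ (⊤ : ℕ∞) (fun y : E3 => ‖y‖ ^ 2) x := (contDiff_norm_sq ℝ).contDiffAt
  unfold gradEta3
  exact ((contDiffAt_const.div (h.mul contDiffAt_const) (by positivity)).neg).smul contDiffAt_id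

lemma Psi_ev (ε α : ℝ) (z x : E3) (h1 : ε < ‖x‖) (h2 : ‖x‖ < α * ε) :
    Psi3 ε α z =ᶠ[nhds x] fun y => eta 3 ε α y • z + cross3 (gradEta3 α y) (vz z y) := by
  filter_upwards [ann_nhds ε α x h1 h2] with y hy
  unfold Psi3
  rw [if_neg (not_le.2 hy.1), if_pos hy.2]

lemma Psi_smooth (ε α : ℝ) (hε : 0 < ε) (hα : 1 < α) (z x : E3) (h1 : ε < ‖x‖)
    (h2 : ‖x‖ < α * ε) : ContDiffAt ℝ (⊤ : ℕ∞)
      (fun y => eta 3 ε α y • z + cross3 (gradEta3 α y) (vz z y)) x :=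
  ((eta_smooth ε α hε hα x h1 h2).smul contDiffAt_const).add
    (cross_smooth _ _ _ (grad_smooth α hα x (hε.trans h1).ne') (vz_smooth z x))

lemma fderiv_line (F : E3 → E3) (x e : E3) (i : Fin 3) (d : ℝ) (hF : DifferentiableAt ℝ F x)
    (h : HasDerivAt (fun t : ℝ => F (x + t • e) i) d 0) : fderiv ℝ F x e i = d := by
  have h1 : HasDerivAt (fun t : ℝ => F (x + t • e)) (fderiv ℝ F x e) 0 :=
    hF.hasFDerivAt.hasLineDerivAt e
  have h2 : HasDerivAt (fun t : ℝ => F (x + t • e) i) (fderiv ℝ F x e i) 0 :=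
    (EuclideanSpace.proj (𝕜 := ℝ) i : E3 →L[ℝ] ℝ).hasFDerivAt.comp_hasDerivAt (0 : ℝ) h1
  exact h2.unique h

lemma line_coord (x : E3) (i j : Fin 3) :
    HasDerivAt (fun t : ℝ => (x + t • (EuclideanSpace.single j 1 : E3)) i)
      (if i = j then 1 else 0) 0 := by
  have : HasDerivAt (fun t : ℝ => x i + t * (if i = j then 1 else 0))
      (1 * (if i = j then 1 else 0)) (0 : ℝ) :=
    ((hasDerivAt_id (0 : ℝ)).mul_const _).const_add _
  simpa using this

lemma line_normsq (x : E3) (j : Fin 3) :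
    HasDerivAt (fun t : ℝ => ‖x + t • (EuclideanSpace.single j 1 : E3)‖ ^ 2) (2 * x j) 0 := by
  have h : (fun t : ℝ => ‖x + t • (EuclideanSpace.single j 1 : E3)‖ ^ 2) = fun t : ℝ =>
      ∑ i, (x + t • (EuclideanSpace.single j 1 : E3)) i * (x + t • (EuclideanSpace.single j 1 : E3)) i := by
    funext t
    rw [EuclideanSpace.real_norm_sq_eq]
    simp only [sq]
  rw [h]
  have := HasDerivAt.fun_sum (u := Finset.univ) (fun i _ => (line_coord x i j).mul (line_coord x i j))
  refine HasDerivAt.congr_deriv this ?_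
  simp only [zero_smul, add_zero, Fin.sum_univ_three]
  fin_cases j <;> simp <;> ring

lemma line_eta (ε α : ℝ) (hε : 0 < ε) (hα : 1 < α) (x : E3) (h1 : ε < ‖x‖)
    (h2 : ‖x‖ < α * ε) (j : Fin 3) :
    HasDerivAt (fun t : ℝ => eta 3 ε α (x + t • (EuclideanSpace.single j 1 : E3)))
      (-(x j / (‖x‖ ^ 2 * Real.log α))) 0 := by
  have hx : ‖x‖ ≠ 0 := (hε.trans h1).ne'
  have hl : Real.log α ≠ 0 := (Real.log_pos hα).ne'
  have hc : Filter.Tendsto (fun t : ℝ => x + t • (EuclideanSpace.single j 1 : E3)) (nhds 0) (nhds x) := by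
    have : Continuous (fun t : ℝ => x + t • (EuclideanSpace.single j 1 : E3)) := by fun_prop
    simpa using this.tendsto 0
  have h := (((line_normsq x j).log (by simpa using hx)).const_mul (1 / 2 : ℝ)).const_sub
    (Real.log (α * ε)) |>.div_const (Real.log α)
  refine HasDerivAt.congr_of_eventuallyEq (HasDerivAt.congr_deriv h ?_) ?_
  · simp
    field_simp
  · filter_upwards [hc.eventually (ann_nhds ε α x h1 h2)] with t ht
    exact eta_ann ε α hε hα _ ht.1 ht.2

lemma line_grad (α : ℝ) (hα : 1 < α) (x : E3) (hx : ‖x‖ ≠ 0) (i j : Fin 3) :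
    HasDerivAt (fun t : ℝ => gradEta3 α (x + t • (EuclideanSpace.single j 1 : E3)) i)
      (2 * x j * x i / ((‖x‖ ^ 2) ^ 2 * Real.log α)
        - (if i = j then 1 else 0) / (‖x‖ ^ 2 * Real.log α)) 0 := by
  have hl : Real.log α ≠ 0 := (Real.log_pos hα).ne'
  have h := (((line_normsq x j).mul_const (Real.log α)).inv (by simp [hx, hl])).neg.mul
    (line_coord x i j)
  have e : (fun t : ℝ => gradEta3 α (x + t • (EuclideanSpace.single j 1 : E3)) i) = fun t : ℝ =>
     -(‖x + t • (EuclideanSpace.single j 1 : E3)‖ ^ 2 * Real.log α)⁻¹ *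
      (x + t • (EuclideanSpace.single j 1 : E3)) i := by
    funext t
    simp only [gradEta3, PiLp.smul_apply, smul_eq_mul, one_div]
  rw [e]
  refine HasDerivAt.congr_deriv h ?_
  simp only [zero_smul, add_zero, Pi.neg_apply, Pi.inv_apply]
  field_simp
  ring

lemma curl_part (ε α : ℝ) (hε : 0 < ε) (hα : 1 < α) (z x : E3) (h1 : ε < ‖x‖)
    (h2 : ‖x‖ < α * ε) : Psi3 ε α z x = curl3 (fun y => eta 3 ε α y • vz z y) x := by
  rw [(Psi_ev ε α z x h1 h2).eq_of_nhds]
  have hd : DifferentiableAt ℝ (fun y => eta 3 ε α y • vz z y) x :=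
    ((eta_smooth ε α hε hα x h1 h2).smul (vz_smooth z x)).differentiableAt (by simp)
  have key : ∀ j i k : Fin 3, ∀ c : ℝ, (∀ y, vz z y i = c * y k) →
      fderiv ℝ (fun y => eta 3 ε α y • vz z y) x (EuclideanSpace.single j 1) i =
        -(x j / (‖x‖ ^ 2 * Real.log α)) * (c * x k) + eta 3 ε α x * (c * if k = j then 1 else 0) := by
    intro j i k c hc
    apply fderiv_line _ _ _ _ _ hd
    have h := (line_eta ε α hε hα x h1 h2 j).mul ((line_coord x k j).const_mul c)
    simp only [zero_smul, add_zero] at h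
    refine h.congr_of_eventuallyEq (Filter.Eventually.of_forall fun t => ?_)
    simp [hc]
  have k0 : ∀ y, vz z y 0 = z 1 * y 2 := fun y => by simp [vz]
  have k1 : ∀ y, vz z y 1 = z 2 * y 0 := fun y => by simp [vz]
  have k2 : ∀ y, vz z y 2 = z 0 * y 1 := fun y => by simp [vz]
  unfold curl3
  rw [key 1 2 _ _ k2, key 2 1 _ _ k1, key 2 0 _ _ k0, key 0 2 _ _ k2, key 0 1 _ _ k1,
    key 1 0 _ _ k0]
  ext i
  fin_cases i <;> simp [cross3, k0, k1, k2, gradEta3] <;> ring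

lemma div_part (ε α : ℝ) (hε : 0 < ε) (hα : 1 < α) (z x : E3) (h1 : ε < ‖x‖)
    (h2 : ‖x‖ < α * ε) : div3 (Psi3 ε α z) x = 0 := by
  have hx : ‖x‖ ≠ 0 := (hε.trans h1).ne'
  have hl : Real.log α ≠ 0 := (Real.log_pos hα).ne'
  have hd := (Psi_smooth ε α hε hα z x h1 h2).differentiableAt (by simp)
  unfold div3
  rw [(Psi_ev ε α z x h1 h2).fderiv_eq, Fin.sum_univ_three]
  have E := line_eta ε α hε hα x h1 h2
  have G := line_grad α hα x hx
  have C := line_coord x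
  rw [fderiv_line _ x _ 0 _ hd (((((E 0).mul_const (z 0)).add
      (((G 1 0).mul ((C 1 0).const_mul (z 0))).sub ((G 2 0).mul ((C 0 0).const_mul (z 2)))))
      ).congr_of_eventuallyEq (Filter.Eventually.of_forall fun t => by simp [cross3, vz])),
    fderiv_line _ x _ 1 _ hd (((((E 1).mul_const (z 1)).add
      (((G 2 1).mul ((C 2 1).const_mul (z 1))).sub ((G 0 1).mul ((C 1 1).const_mul (z 0)))))
      ).congr_of_eventuallyEq (Filter.Eventually.of_forall fun t => by simp [cross3, vz])),
    fderiv_line _ x _ 2 _ hd (((((E 2).mul_const (z 2)).add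
      (((G 0 2).mul ((C 0 2).const_mul (z 2))).sub ((G 1 2).mul ((C 2 2).const_mul (z 1)))))
      ).congr_of_eventuallyEq (Filter.Eventually.of_forall fun t => by simp [cross3, vz]))]
  simp [gradEta3]
  field_simp
  ring

/-- `Ψ_{ε,α}[z]` (d = 3) equals `z` on `{|x| ≤ ε}`, vanishes on `{|x| ≥ αε}`, is smooth on
the open annulus where it coincides with `curl(η_{ε,α} v_z)`, and is divergence free at
every point `x` with `|x| ∉ {ε, αε}`. -/
theorem Psi3_properties (ε α : ℝ) (hε : 0 < ε) (hα : 1 < α) (z : EuclideanSpace ℝ (Fin 3)) :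
    (∀ x, ‖x‖ ≤ ε → Psi3 ε α z x = z) ∧
    (∀ x, α * ε ≤ ‖x‖ → Psi3 ε α z x = 0) ∧
    ContDiffOn ℝ (⊤ : ℕ∞) (Psi3 ε α z) {x | ε < ‖x‖ ∧ ‖x‖ < α * ε} ∧
    (∀ x, ε < ‖x‖ → ‖x‖ < α * ε →
      Psi3 ε α z x = curl3 (fun y => eta 3 ε α y • vz z y) x) ∧
    (∀ x, ‖x‖ ≠ ε → ‖x‖ ≠ α * ε → div3 (Psi3 ε α z) x = 0) := by
  refine ⟨fun x hx => by simp [Psi3, hx], fun x hx => ?_, fun x hx => ?_,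
    fun x h1 h2 => curl_part ε α hε hα z x h1 h2, fun x h1 h2 => ?_⟩
  · have : ε < α * ε := by nlinarith
    unfold Psi3
    rw [if_neg (by linarith), if_neg (by linarith)]
  · exact ((Psi_smooth ε α hε hα z x hx.1 hx.2).congr_of_eventuallyEq
      (Psi_ev ε α z x hx.1 hx.2)).contDiffWithinAt
  · have c : ContinuousAt (fun y : E3 => ‖y‖) x := continuous_norm.continuousAt
    have hlt : ε < α * ε := by nlinarith
    rcases lt_or_gt_of_ne h1 with h | h
    · have : Psi3 ε α z =ᶠ[nhds x] fun _ => z := by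
        filter_upwards [c.eventually_lt_const h] with y hy
        simp [Psi3, hy.le]
      unfold div3
      rw [this.fderiv_eq]
      simp
    · rcases lt_or_gt_of_ne h2 with h' | h'
      · exact div_part ε α hε hα z x h h'
      · have : Psi3 ε α z =ᶠ[nhds x] fun _ => 0 := by
          filter_upwards [c.eventually_const_lt h'] with y hy
          unfold Psi3
          rw [if_neg (by linarith), if_neg (by linarith)]
        unfold div3
        rw [this.fderiv_eq]
        simp
end

section
/- For all ε > 0, α > 1 and z ∈ ℝ², the vector field Ψ_{ε,α}[z] : ℝ² → ℝ² equals the constant vector z on {|x| ≤ ε}, vanishes on {|x| ≥ αε}, is smooth on the open annulus {ε < |x| < αε} where it coincides with ∇⊥(η_{ε,α} g_z), and its divergence vanishes at every point x with |x| ∉ {ε, αε}. -/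
/-- The scalar field `g_z(x) = z₂x₁ − z₁x₂` (1-based indices). -/
noncomputable def gz (z x : EuclideanSpace ℝ (Fin 2)) : ℝ := z 1 * x 0 - z 0 * x 1

/-- The perpendicular gradient `∇⊥h = (-∂₂h, ∂₁h)` of a scalar field on `ℝ²`. -/
noncomputable def perpGrad (h : EuclideanSpace ℝ (Fin 2) → ℝ) (x : EuclideanSpace ℝ (Fin 2)) :
    EuclideanSpace ℝ (Fin 2) :=
  (WithLp.equiv 2 (Fin 2 → ℝ)).symm
    ![-(fderiv ℝ h x (EuclideanSpace.single 1 1)), fderiv ℝ h x (EuclideanSpace.single 0 1)]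

/-- `∇⊥η_{ε,α}(x)` on the annulus, computed from `∇η_{ε,α}(x) = -x/(|x|² log α)`. -/
noncomputable def perpGradEta2 (α : ℝ) (x : EuclideanSpace ℝ (Fin 2)) :
    EuclideanSpace ℝ (Fin 2) :=
  (WithLp.equiv 2 (Fin 2 → ℝ)).symm
    ![x 1 / (‖x‖ ^ 2 * Real.log α), -(x 0) / (‖x‖ ^ 2 * Real.log α)]

/-- The divergence-free cut-off field `Ψ_{ε,α}[z]` in dimension 2:
equal to `z` for `|x| ≤ ε`, to `η_{ε,α} z + g_z ∇⊥η_{ε,α}` for `ε < |x| < αε`,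
and to `0` for `|x| ≥ αε`. -/
noncomputable def Psi2 (ε α : ℝ) (z x : EuclideanSpace ℝ (Fin 2)) : EuclideanSpace ℝ (Fin 2) :=
  if ‖x‖ ≤ ε then z
  else if ‖x‖ < α * ε then eta 2 ε α x • z + gz z x • perpGradEta2 α x
  else 0

/-- Divergence of a vector field on `ℝ²`. -/
noncomputable def div2 (F : EuclideanSpace ℝ (Fin 2) → EuclideanSpace ℝ (Fin 2))
    (x : EuclideanSpace ℝ (Fin 2)) : ℝ :=
  ∑ i, fderiv ℝ F x (EuclideanSpace.single i 1) i

/-- Explicit (squared-norm based) formula for the cut-off on the annulus. -/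
noncomputable def etaExp (ε α : ℝ) (x : EuclideanSpace ℝ (Fin 2)) : ℝ :=
  (Real.log (α * ε) - Real.log (x 0 ^ 2 + x 1 ^ 2) / 2) / Real.log α

/-- First component of the field on the annulus. -/
noncomputable def comp0 (ε α : ℝ) (z x : EuclideanSpace ℝ (Fin 2)) : ℝ :=
  etaExp ε α x * z 0 + gz z x * (x 1 / ((x 0 ^ 2 + x 1 ^ 2) * Real.log α))

/-- Second component of the field on the annulus. -/
noncomputable def comp1 (ε α : ℝ) (z x : EuclideanSpace ℝ (Fin 2)) : ℝ :=
  etaExp ε α x * z 1 + gz z x * (-(x 0) / ((x 0 ^ 2 + x 1 ^ 2) * Real.log α))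

lemma normSq2 (x : EuclideanSpace ℝ (Fin 2)) : ‖x‖ ^ 2 = x 0 ^ 2 + x 1 ^ 2 := by
  rw [EuclideanSpace.norm_sq_eq]; simp [Fin.sum_univ_two]

lemma eta_eq (ε α : ℝ) (hε : 0 < ε) (hα : 1 < α) (x : EuclideanSpace ℝ (Fin 2))
    (h1 : ε < ‖x‖) (h2 : ‖x‖ < α * ε) : eta 2 ε α x = etaExp ε α x := by
  unfold eta fAB etaExp
  rw [if_neg (not_lt.mpr h1.le), if_pos h2.le, ← normSq2, Real.log_pow,
    Real.log_mul (by positivity) hε.ne']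
  have hL : Real.log α ≠ 0 := (Real.log_pos hα).ne'
  have hD : Real.log ε - (Real.log α + Real.log ε) = - Real.log α := by ring
  rw [hD]
  field_simp
  push_cast
  ring

lemma psi_eq (ε α : ℝ) (hε : 0 < ε) (hα : 1 < α) (z x : EuclideanSpace ℝ (Fin 2))
    (h1 : ε < ‖x‖) (h2 : ‖x‖ < α * ε) :
    Psi2 ε α z x = WithLp.toLp 2 ![comp0 ε α z x, comp1 ε α z x] := by
  unfold Psi2
  rw [if_neg (not_le.mpr h1), if_pos h2, eta_eq ε α hε hα x h1 h2]
  ext i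
  fin_cases i <;> simp [perpGradEta2, comp0, comp1, normSq2]

lemma annulus_open (ε α : ℝ) :
    IsOpen {x : EuclideanSpace ℝ (Fin 2) | ε < ‖x‖ ∧ ‖x‖ < α * ε} :=
  (isOpen_lt continuous_const continuous_norm).inter (isOpen_lt continuous_norm continuous_const)

lemma coord_hasFDerivAt (i : Fin 2) (x : EuclideanSpace ℝ (Fin 2)) :
    HasFDerivAt (fun y : EuclideanSpace ℝ (Fin 2) => y i)
      (EuclideanSpace.proj i : EuclideanSpace ℝ (Fin 2) →L[ℝ] ℝ) x :=
  (EuclideanSpace.proj i : EuclideanSpace ℝ (Fin 2) →L[ℝ] ℝ).hasFDerivAt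

lemma sq_hasFDerivAt (x : EuclideanSpace ℝ (Fin 2)) :
    HasFDerivAt (fun y : EuclideanSpace ℝ (Fin 2) => y 0 ^ 2 + y 1 ^ 2)
      ((2 * x 0) • (EuclideanSpace.proj 0 : EuclideanSpace ℝ (Fin 2) →L[ℝ] ℝ)
        + (2 * x 1) • (EuclideanSpace.proj 1 : EuclideanSpace ℝ (Fin 2) →L[ℝ] ℝ)) x := by
  have := ((coord_hasFDerivAt 0 x).pow 2).add ((coord_hasFDerivAt 1 x).pow 2)
  refine HasFDerivAt.congr_fderiv (f := fun y : EuclideanSpace ℝ (Fin 2) => y 0 ^ 2 + y 1 ^ 2)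
    this ?_
  ext v; simp

lemma gz_hasFDerivAt (z x : EuclideanSpace ℝ (Fin 2)) :
    HasFDerivAt (gz z)
      ((z 1) • (EuclideanSpace.proj 0 : EuclideanSpace ℝ (Fin 2) →L[ℝ] ℝ)
        - (z 0) • (EuclideanSpace.proj 1 : EuclideanSpace ℝ (Fin 2) →L[ℝ] ℝ)) x :=
  ((coord_hasFDerivAt 0 x).const_mul (z 1)).sub ((coord_hasFDerivAt 1 x).const_mul (z 0))

lemma etaExp_hasFDerivAt (ε α : ℝ) (x : EuclideanSpace ℝ (Fin 2))
    (hx : x 0 ^ 2 + x 1 ^ 2 ≠ 0) :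
    HasFDerivAt (etaExp ε α)
      ((-(1 / ((x 0 ^ 2 + x 1 ^ 2) * Real.log α))) •
        ((x 0) • (EuclideanSpace.proj 0 : EuclideanSpace ℝ (Fin 2) →L[ℝ] ℝ)
        + (x 1) • (EuclideanSpace.proj 1 : EuclideanSpace ℝ (Fin 2) →L[ℝ] ℝ))) x := by
  have := ((((sq_hasFDerivAt x).log hx).mul_const (1 / 2)).const_sub
    (Real.log (α * ε))).mul_const (Real.log α)⁻¹
  have e : etaExp ε α = fun y : EuclideanSpace ℝ (Fin 2) =>
      (Real.log (α * ε) - Real.log (y 0 ^ 2 + y 1 ^ 2) * (1 / 2)) * (Real.log α)⁻¹ := by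
    ext y; simp [etaExp, div_eq_mul_inv]
  rw [e]
  refine this.congr_fderiv ?_
  ext v; simp; ring

/-- Derivative of `1 / (|x|² log α)`. -/
lemma inv_hasFDerivAt (α : ℝ) (x : EuclideanSpace ℝ (Fin 2))
    (hx : x 0 ^ 2 + x 1 ^ 2 ≠ 0) :
    HasFDerivAt (fun y : EuclideanSpace ℝ (Fin 2) => (y 0 ^ 2 + y 1 ^ 2)⁻¹ * (Real.log α)⁻¹)
      ((-(2 / ((x 0 ^ 2 + x 1 ^ 2) ^ 2 * Real.log α))) •
        ((x 0) • (EuclideanSpace.proj 0 : EuclideanSpace ℝ (Fin 2) →L[ℝ] ℝ)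
        + (x 1) • (EuclideanSpace.proj 1 : EuclideanSpace ℝ (Fin 2) →L[ℝ] ℝ))) x := by
  have := ((hasDerivAt_inv hx).comp_hasFDerivAt x (sq_hasFDerivAt x)).mul_const (Real.log α)⁻¹
  refine HasFDerivAt.congr_fderiv
    (f := fun y : EuclideanSpace ℝ (Fin 2) => (y 0 ^ 2 + y 1 ^ 2)⁻¹ * (Real.log α)⁻¹) this ?_
  generalize x 0 ^ 2 + x 1 ^ 2 = s
  ext v; simp [div_eq_mul_inv, mul_inv]; ring

lemma comp_div (ε α : ℝ) (hα : 1 < α) (z x : EuclideanSpace ℝ (Fin 2))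
    (hx : x 0 ^ 2 + x 1 ^ 2 ≠ 0) :
    fderiv ℝ (comp0 ε α z) x (EuclideanSpace.single 0 1)
      + fderiv ℝ (comp1 ε α z) x (EuclideanSpace.single 1 1) = 0 := by
  have hL : Real.log α ≠ 0 := (Real.log_pos hα).ne'
  have h0 := ((etaExp_hasFDerivAt ε α x hx).mul_const (z 0)).add
    ((gz_hasFDerivAt z x).mul ((coord_hasFDerivAt 1 x).mul (inv_hasFDerivAt α x hx)))
  have h1 := ((etaExp_hasFDerivAt ε α x hx).mul_const (z 1)).add
    ((gz_hasFDerivAt z x).mul ((coord_hasFDerivAt 0 x).neg.mul (inv_hasFDerivAt α x hx)))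
  have h0' := HasFDerivAt.congr_of_eventuallyEq (f₁ := comp0 ε α z) h0
    (Filter.Eventually.of_forall fun y => by
      simp only [comp0, Pi.add_apply, Pi.mul_apply, Pi.neg_apply, div_eq_mul_inv, mul_inv])
  have h1' := HasFDerivAt.congr_of_eventuallyEq (f₁ := comp1 ε α z) h1
    (Filter.Eventually.of_forall fun y => by
      simp only [comp1, Pi.add_apply, Pi.mul_apply, Pi.neg_apply, div_eq_mul_inv, mul_inv])
  rw [h0'.fderiv, h1'.fderiv]
  simp [gz]
  field_simp
  ring

lemma etaExp_contDiffAt (ε α : ℝ) (x : EuclideanSpace ℝ (Fin 2))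
    (hx : x 0 ^ 2 + x 1 ^ 2 ≠ 0) : ContDiffAt ℝ (⊤ : ℕ∞) (etaExp ε α) x := by
  have hs : ContDiffAt ℝ (⊤ : ℕ∞)
      (fun y : EuclideanSpace ℝ (Fin 2) => y 0 ^ 2 + y 1 ^ 2) x := by fun_prop
  unfold etaExp
  refine ContDiffAt.div_const (ContDiffAt.sub contDiffAt_const
    (ContDiffAt.div_const (hs.log hx) _)) _

lemma comp_contDiffAt (ε α : ℝ) (hα : 1 < α) (z x : EuclideanSpace ℝ (Fin 2))
    (hx : x 0 ^ 2 + x 1 ^ 2 ≠ 0) :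
    ContDiffAt ℝ (⊤ : ℕ∞) (comp0 ε α z) x ∧ ContDiffAt ℝ (⊤ : ℕ∞) (comp1 ε α z) x := by
  have hL : Real.log α ≠ 0 := (Real.log_pos hα).ne'
  have he := etaExp_contDiffAt ε α x hx
  constructor
  · unfold comp0 gz
    exact (he.mul contDiffAt_const).add (ContDiffAt.mul (by fun_prop)
      (ContDiffAt.div (by fun_prop) (by fun_prop) (mul_ne_zero hx hL)))
  · unfold comp1 gz
    exact (he.mul contDiffAt_const).add (ContDiffAt.mul (by fun_prop)
      (ContDiffAt.div (by fun_prop) (by fun_prop) (mul_ne_zero hx hL)))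

lemma psi_contDiffAt (ε α : ℝ) (hε : 0 < ε) (hα : 1 < α) (z x : EuclideanSpace ℝ (Fin 2))
    (h1 : ε < ‖x‖) (h2 : ‖x‖ < α * ε) : ContDiffAt ℝ (⊤ : ℕ∞) (Psi2 ε α z) x := by
  have hx : x 0 ^ 2 + x 1 ^ 2 ≠ 0 := by
    rw [← normSq2]; have := hε.trans h1; positivity
  obtain ⟨c0, c1⟩ := comp_contDiffAt ε α hα z x hx
  have hev : ∀ᶠ y in nhds x, ε < ‖y‖ ∧ ‖y‖ < α * ε := (annulus_open ε α).mem_nhds ⟨h1, h2⟩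
  refine ContDiffAt.congr_of_eventuallyEq
    (f := fun y => WithLp.toLp 2 ![comp0 ε α z y, comp1 ε α z y]) ?_
    (hev.mono fun y hy => psi_eq ε α hε hα z y hy.1 hy.2)
  rw [contDiffAt_piLp]
  intro i
  fin_cases i
  · simpa using c0
  · simpa using c1

/-- `Ψ_{ε,α}[z]` (d = 2) equals `z` on `{|x| ≤ ε}`, vanishes on `{|x| ≥ αε}`, is smooth on
the open annulus where it coincides with `∇⊥(η_{ε,α} g_z)`, and is divergence free at
every point `x` with `|x| ∉ {ε, αε}`. -/
theorem Psi2_properties (ε α : ℝ) (hε : 0 < ε) (hα : 1 < α) (z : EuclideanSpace ℝ (Fin 2)) :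
    (∀ x, ‖x‖ ≤ ε → Psi2 ε α z x = z) ∧
    (∀ x, α * ε ≤ ‖x‖ → Psi2 ε α z x = 0) ∧
    ContDiffOn ℝ (⊤ : ℕ∞) (Psi2 ε α z) {x | ε < ‖x‖ ∧ ‖x‖ < α * ε} ∧
    (∀ x, ε < ‖x‖ → ‖x‖ < α * ε →
      Psi2 ε α z x = perpGrad (fun y => eta 2 ε α y * gz z y) x) ∧
    (∀ x, ‖x‖ ≠ ε → ‖x‖ ≠ α * ε → div2 (Psi2 ε α z) x = 0) := by
  have hne : ∀ x : EuclideanSpace ℝ (Fin 2), ε < ‖x‖ → x 0 ^ 2 + x 1 ^ 2 ≠ 0 := by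
    intro x h1
    rw [← normSq2]; have := hε.trans h1; positivity
  have hev : ∀ x : EuclideanSpace ℝ (Fin 2), ε < ‖x‖ → ‖x‖ < α * ε →
      ∀ᶠ y in nhds x, ε < ‖y‖ ∧ ‖y‖ < α * ε :=
    fun x h1 h2 => (annulus_open ε α).mem_nhds ⟨h1, h2⟩
  have hlt : ε < α * ε := by nlinarith
  have hin : ∀ x, ‖x‖ ≤ ε → Psi2 ε α z x = z := fun x hx => by simp [Psi2, hx]
  have hout : ∀ x, α * ε ≤ ‖x‖ → Psi2 ε α z x = 0 := fun x hx => by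
    unfold Psi2
    rw [if_neg (not_le.mpr (hlt.trans_le hx)), if_neg (not_lt.mpr hx)]
  refine ⟨hin, hout, ?_, ?_, ?_⟩
  · intro x hx
    exact (psi_contDiffAt ε α hε hα z x hx.1 hx.2).contDiffWithinAt
  · intro x h1 h2
    have hx := hne x h1
    have hL : Real.log α ≠ 0 := (Real.log_pos hα).ne'
    have hd := (etaExp_hasFDerivAt ε α x hx).mul (gz_hasFDerivAt z x)
    have hd' := HasFDerivAt.congr_of_eventuallyEq
      (f₁ := fun y => eta 2 ε α y * gz z y) hd
      ((hev x h1 h2).mono fun y hy => by simp [eta_eq ε α hε hα y hy.1 hy.2])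
    rw [psi_eq ε α hε hα z x h1 h2]
    unfold perpGrad
    rw [hd'.fderiv]
    ext i
    fin_cases i
    · simp [comp0]
      field_simp
      ring
    · simp [comp1]
      field_simp
  · intro x hxe hxa
    rcases lt_or_gt_of_ne hxe with h | h1
    · have : Psi2 ε α z =ᶠ[nhds x] fun _ => z :=
        Filter.Eventually.mono ((isOpen_lt continuous_norm continuous_const).mem_nhds h :
          ∀ᶠ y in nhds x, ‖y‖ < ε) fun y hy => hin y (le_of_lt hy)
      simp [div2, this.fderiv_eq]
    rcases lt_or_gt_of_ne hxa with h2 | h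
    · have hdiff : DifferentiableAt ℝ (Psi2 ε α z) x :=
        (psi_contDiffAt ε α hε hα z x h1 h2).differentiableAt (by simp)
      have key : ∀ (i : Fin 2) (v : EuclideanSpace ℝ (Fin 2)),
          fderiv ℝ (Psi2 ε α z) x v i = fderiv ℝ (fun y => Psi2 ε α z y i) x v := by
        intro i v
        have := (EuclideanSpace.proj i : EuclideanSpace ℝ (Fin 2) →L[ℝ] ℝ).hasFDerivAt.comp x
          hdiff.hasFDerivAt
        have h3 : HasFDerivAt (fun y => Psi2 ε α z y i) _ x := this
        rw [h3.fderiv]; rfl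
      have k0 : (fun y => Psi2 ε α z y 0) =ᶠ[nhds x] comp0 ε α z :=
        (hev x h1 h2).mono fun y hy => by simp [psi_eq ε α hε hα z y hy.1 hy.2]
      have k1 : (fun y => Psi2 ε α z y 1) =ᶠ[nhds x] comp1 ε α z :=
        (hev x h1 h2).mono fun y hy => by simp [psi_eq ε α hε hα z y hy.1 hy.2]
      unfold div2
      rw [Fin.sum_univ_two, key, key, k0.fderiv_eq, k1.fderiv_eq]
      exact comp_div ε α hα z x (hne x h1)
    · have : Psi2 ε α z =ᶠ[nhds x] fun _ => 0 :=
        Filter.Eventually.mono ((isOpen_lt continuous_const continuous_norm).mem_nhds h :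
          ∀ᶠ y in nhds x, α * ε < ‖y‖) fun y hy => hout y (le_of_lt hy)
      simp [div2, this.fderiv_eq]
end

section
/- Let d ∈ {2,3}, ε > 0, α > 1 and z ∈ ℝ^d. Then the pointwise bound |Ψ_{ε,α}[z](x)| ≤ |z| (1 + 1/log α) holds for every x ∈ ℝ^d with |x| ∉ {ε, αε}. -/
theorem eta_mem (d : ℕ) (ε α : ℝ) (hε : 0 < ε) (hα : 1 < α) (x : EuclideanSpace ℝ (Fin d))
    (h1 : ε < ‖x‖) (h2 : ‖x‖ < α * ε) : |eta d ε α x| ≤ 1 := by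
  have hx : 0 < ‖x‖ := hε.trans h1
  have l1 := Real.log_lt_log hε h1
  have l2 := Real.log_lt_log hx h2
  unfold eta fAB
  rw [if_neg (not_lt.mpr h1.le), if_pos h2.le, abs_div, abs_of_neg (by linarith),
    abs_of_neg (by linarith), div_le_one (by linarith)]
  linarith

theorem cross_bound (α : ℝ) (hα : 1 < α) (z x : EuclideanSpace ℝ (Fin 3)) (hx : 0 < ‖x‖) :
    ‖cross3 (gradEta3 α x) (vz z x)‖ ≤ ‖z‖ * (1 / Real.log α) := by
  have hl : 0 < Real.log α := Real.log_pos hα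
  have hX := EuclideanSpace.real_norm_sq_eq x
  have hZ := EuclideanSpace.real_norm_sq_eq z
  rw [Fin.sum_univ_three] at hX hZ
  refine le_of_abs_le (abs_le_of_sq_le_sq ?_ ?_)
  rw [EuclideanSpace.real_norm_sq_eq, Fin.sum_univ_three]
  have hc : ‖z‖ * (1 / Real.log α) = ‖z‖ * ‖x‖ ^ 2 * (1 / (‖x‖ ^ 2 * Real.log α)) := by
    field_simp
  rw [hc, mul_pow, mul_pow, hZ]
  have hX2 : (‖x‖ ^ 2) ^ 2 = (x 0 ^ 2 + x 1 ^ 2 + x 2 ^ 2) ^ 2 := by rw [hX]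
  rw [hX2]
  simp only [cross3, gradEta3, vz, WithLp.equiv_symm_apply, PiLp.smul_apply, smul_eq_mul,
    Matrix.cons_val]
  generalize 1 / (‖x‖ ^ 2 * Real.log α) = c
  generalize x 0 = a
  generalize x 1 = b
  generalize x 2 = e
  generalize z 0 = p
  generalize z 1 = q
  generalize z 2 = r
  have key : (b * (p * b) - e * (r * a)) ^ 2 + (e * (q * e) - a * (p * b)) ^ 2
      + (a * (r * a) - b * (q * e)) ^ 2 ≤ (p^2+q^2+r^2) * (a^2+b^2+e^2)^2 := by
    have h1 : (b * (p * b) - e * (r * a)) ^ 2 + (e * (q * e) - a * (p * b)) ^ 2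
      + (a * (r * a) - b * (q * e)) ^ 2 ≤ (a^2+b^2+e^2) * ((q*e)^2+(r*a)^2+(p*b)^2) := by
      nlinarith [sq_nonneg (a*(q*e)+b*(r*a)+e*(p*b))]
    have h2 : (q*e)^2+(r*a)^2+(p*b)^2 ≤ (p^2+q^2+r^2) * (a^2+b^2+e^2) := by
      nlinarith [sq_nonneg (q*a), sq_nonneg (q*b), sq_nonneg (r*b), sq_nonneg (r*e),
        sq_nonneg (p*a), sq_nonneg (p*e)]
    nlinarith [mul_le_mul_of_nonneg_left h2 (by positivity : 0 ≤ a^2+b^2+e^2)]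
  have := mul_le_mul_of_nonneg_right key (sq_nonneg c)
  linarith
  positivity

theorem perp_bound (α : ℝ) (hα : 1 < α) (z x : EuclideanSpace ℝ (Fin 2)) (hx : 0 < ‖x‖) :
    ‖gz z x • perpGradEta2 α x‖ ≤ ‖z‖ * (1 / Real.log α) := by
  have hl : 0 < Real.log α := Real.log_pos hα
  have hX := EuclideanSpace.real_norm_sq_eq x
  have hZ := EuclideanSpace.real_norm_sq_eq z
  rw [Fin.sum_univ_two] at hX hZ
  refine le_of_abs_le (abs_le_of_sq_le_sq ?_ ?_)
  rw [EuclideanSpace.real_norm_sq_eq, Fin.sum_univ_two]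
  have hc : ‖z‖ * (1 / Real.log α) = ‖z‖ * ‖x‖ ^ 2 * (1 / (‖x‖ ^ 2 * Real.log α)) := by
    field_simp
  rw [hc, mul_pow, mul_pow, hZ]
  have hX2 : (‖x‖ ^ 2) ^ 2 = (x 0 ^ 2 + x 1 ^ 2) ^ 2 := by rw [hX]
  rw [hX2]
  simp only [gz, perpGradEta2, WithLp.equiv_symm_apply, PiLp.smul_apply, smul_eq_mul,
    Matrix.cons_val, div_eq_mul_one_div (x 1), div_eq_mul_one_div (-x 0)]
  generalize 1 / (‖x‖ ^ 2 * Real.log α) = c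
  generalize x 0 = a
  generalize x 1 = b
  generalize z 0 = p
  generalize z 1 = q
  have key : (q * a - p * b) ^ 2 * (a^2+b^2) ≤ (p^2+q^2) * (a^2+b^2)^2 := by
    have h1 : (q * a - p * b) ^ 2 ≤ (p^2+q^2) * (a^2+b^2) := by
      nlinarith [sq_nonneg (p*a+q*b)]
    nlinarith [mul_le_mul_of_nonneg_right h1 (by positivity : 0 ≤ a^2+b^2)]
  have := mul_le_mul_of_nonneg_right key (sq_nonneg c)
  linarith
  positivity

theorem combine {E : Type*} [NormedAddCommGroup E] [NormedSpace ℝ E] (t L : ℝ) (z w : E)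
    (ht : |t| ≤ 1) (hw : ‖w‖ ≤ ‖z‖ * L) : ‖t • z + w‖ ≤ ‖z‖ * (1 + L) := by
  have h := norm_add_le (t • z) w
  rw [norm_smul, Real.norm_eq_abs] at h
  nlinarith [mul_le_mul_of_nonneg_right ht (norm_nonneg z)]

/-- Pointwise bound `|Ψ_{ε,α}[z](x)| ≤ |z| (1 + 1/log α)` for `|x| ∉ {ε, αε}`,
in dimensions `d = 2` and `d = 3`. -/
theorem Psi_pointwise_bound (ε α : ℝ) (hε : 0 < ε) (hα : 1 < α) :
    (∀ (z x : EuclideanSpace ℝ (Fin 2)), ‖x‖ ≠ ε → ‖x‖ ≠ α * ε →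
      ‖Psi2 ε α z x‖ ≤ ‖z‖ * (1 + 1 / Real.log α)) ∧
    (∀ (z x : EuclideanSpace ℝ (Fin 3)), ‖x‖ ≠ ε → ‖x‖ ≠ α * ε →
      ‖Psi3 ε α z x‖ ≤ ‖z‖ * (1 + 1 / Real.log α)) := by
  have hl : 0 < 1 / Real.log α := one_div_pos.mpr (Real.log_pos hα)
  constructor
  · intro z x _ _
    unfold Psi2
    split_ifs with h1 h2
    · nlinarith [norm_nonneg z]
    · have h1 := not_le.mp h1
      exact combine _ _ _ _ (eta_mem 2 ε α hε hα x h1 h2) (perp_bound α hα z x (hε.trans h1))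
    · rw [norm_zero]; positivity
  · intro z x _ _
    unfold Psi3
    split_ifs with h1 h2
    · nlinarith [norm_nonneg z]
    · have h1 := not_le.mp h1
      exact combine _ _ _ _ (eta_mem 3 ε α hε hα x h1 h2) (cross_bound α hα z x (hε.trans h1))
    · rw [norm_zero]; positivity
end

section
/- There is a universal constant C > 0 (one may take C = 500π) such that for all ε > 0, α > 1 and z ∈ ℝ³, ∫_{{x ∈ ℝ³ : ε < |x| < αε}} ‖DΨ_{ε,α}[z](x)‖³ dx ≤ C |z|³ / (log α)², where DΨ denotes the Fréchet derivative of Ψ_{ε,α}[z] on the annulus and ‖·‖ the operator norm. -/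
open MeasureTheory

theorem norm_vz_le (z x : EuclideanSpace ℝ (Fin 3)) : ‖vz z x‖ ≤ ‖z‖ * ‖x‖ := by
  have h : ‖vz z x‖ ^ 2 ≤ (‖z‖ * ‖x‖) ^ 2 := by
    rw [mul_pow, EuclideanSpace.norm_sq_eq, EuclideanSpace.norm_sq_eq, EuclideanSpace.norm_sq_eq]
    simp [vz, Fin.sum_univ_three]
    nlinarith [sq_nonneg (z 0 * x 0), sq_nonneg (z 0 * x 1), sq_nonneg (z 0 * x 2),
      sq_nonneg (z 1 * x 0), sq_nonneg (z 1 * x 1), sq_nonneg (z 1 * x 2),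
      sq_nonneg (z 2 * x 0), sq_nonneg (z 2 * x 1), sq_nonneg (z 2 * x 2)]
  exact abs_le_of_sq_le_sq' h (by positivity) |>.2

theorem norm_cross3_le (a b : EuclideanSpace ℝ (Fin 3)) : ‖cross3 a b‖ ≤ ‖a‖ * ‖b‖ := by
  have h : ‖cross3 a b‖ ^ 2 ≤ (‖a‖ * ‖b‖) ^ 2 := by
    rw [mul_pow, EuclideanSpace.norm_sq_eq, EuclideanSpace.norm_sq_eq, EuclideanSpace.norm_sq_eq]
    simp [cross3, Fin.sum_univ_three]
    nlinarith [sq_nonneg (a 0 * b 0 + a 1 * b 1 + a 2 * b 2)]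
  exact abs_le_of_sq_le_sq' h (by positivity) |>.2

/-- The bilinear map `(x, y) ↦ x × v_z(y)`. -/
noncomputable def crossB (z : EuclideanSpace ℝ (Fin 3)) :
    EuclideanSpace ℝ (Fin 3) →L[ℝ] EuclideanSpace ℝ (Fin 3) →L[ℝ] EuclideanSpace ℝ (Fin 3) :=
  LinearMap.mkContinuous₂ (LinearMap.mk₂ ℝ (fun x y => cross3 x (vz z y))
    (by intro a b c; ext i; fin_cases i <;> simp [cross3, vz] <;> ring)
    (by intro a b c; ext i; fin_cases i <;> simp [cross3, vz] <;> ring)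
    (by intro a b c; ext i; fin_cases i <;> simp [cross3, vz] <;> ring)
    (by intro a b c; ext i; fin_cases i <;> simp [cross3, vz] <;> ring)) ‖z‖
    (by
      intro x y
      have h1 := norm_cross3_le x (vz z y)
      have h2 := norm_vz_le z y
      have h3 := mul_le_mul_of_nonneg_left h2 (norm_nonneg x)
      simp only [LinearMap.mk₂_apply]
      nlinarith)

theorem crossB_apply (z x y : EuclideanSpace ℝ (Fin 3)) :
    crossB z x y = cross3 x (vz z y) := rfl

theorem norm_crossB_le (z x y : EuclideanSpace ℝ (Fin 3)) :
    ‖crossB z x y‖ ≤ ‖z‖ * ‖x‖ * ‖y‖ := by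
  rw [crossB_apply]
  have h1 := norm_cross3_le x (vz z y)
  have h3 := mul_le_mul_of_nonneg_left (norm_vz_le z y) (norm_nonneg x)
  nlinarith

theorem Psi3_eq (ε α : ℝ) (hε : 0 < ε) (hα : 1 < α) (z x : EuclideanSpace ℝ (Fin 3))
    (h1 : ε < ‖x‖) (h2 : ‖x‖ < α * ε) :
    Psi3 ε α z x = (-(1 / (2 * Real.log α)) * Real.log (‖x‖ ^ 2)
      + Real.log (α * ε) / Real.log α) • z
      + (-(1 / Real.log α) * (‖x‖ ^ 2)⁻¹) • crossB z x x := by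
  have hL : 0 < Real.log α := Real.log_pos hα
  have hc : cross3 (gradEta3 α x) (vz z x)
      = (-(1 / Real.log α) * (‖x‖ ^ 2)⁻¹) • crossB z x x := by
    have : gradEta3 α x = (-(1 / Real.log α) * (‖x‖ ^ 2)⁻¹) • x := by
      rw [gradEta3]; congr 1; rw [one_div, mul_inv]; ring
    rw [this, ← crossB_apply, map_smul]; rfl
  rw [Psi3, if_neg (not_le.2 h1), if_pos h2, hc]
  congr 2
  rw [eta, fAB, if_neg (not_lt.2 h1.le), if_pos h2.le, Real.log_pow,
    Real.log_mul (by linarith) hε.ne']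
  push_cast
  have : Real.log ε - (Real.log α + Real.log ε) = - Real.log α := by ring
  rw [this]
  field_simp
  ring

theorem norm_fderiv_Psi3_le (ε α : ℝ) (hε : 0 < ε) (hα : 1 < α)
    (z x : EuclideanSpace ℝ (Fin 3)) (h1 : ε < ‖x‖) (h2 : ‖x‖ < α * ε) :
    ‖fderiv ℝ (Psi3 ε α z) x‖ ≤ 5 * ‖z‖ / (‖x‖ * Real.log α) := by
  have hL : 0 < Real.log α := Real.log_pos hα
  have hx : 0 < ‖x‖ := hε.trans h1
  have hev : Psi3 ε α z =ᶠ[nhds x] fun x => (-(1 / (2 * Real.log α)) * Real.log (‖x‖ ^ 2)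
      + Real.log (α * ε) / Real.log α) • z
      + (-(1 / Real.log α) * (‖x‖ ^ 2)⁻¹) • crossB z x x := by
    filter_upwards [continuous_norm.continuousAt.eventually (lt_mem_nhds h1),
      continuous_norm.continuousAt.eventually (gt_mem_nhds h2)] with y hy1 hy2
    exact Psi3_eq ε α hε hα z y hy1 hy2
  have hn : HasFDerivAt (fun y : EuclideanSpace ℝ (Fin 3) => ‖y‖ ^ 2) (2 • innerSL ℝ x) x :=
    (hasStrictFDerivAt_norm_sq x).hasFDerivAt
  have hx2 : ‖x‖ ^ 2 ≠ 0 := by positivity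
  have hB : HasFDerivAt (fun y => crossB z y y) _ x :=
    (crossB z).hasFDerivAt_of_bilinear (hasFDerivAt_id x) (hasFDerivAt_id x)
  have hI : HasFDerivAt (fun y : EuclideanSpace ℝ (Fin 3) => (‖y‖ ^ 2)⁻¹) _ x :=
    (hasDerivAt_inv hx2).comp_hasFDerivAt x hn
  have hD := (((((hn.log hx2).const_mul (-(1 / (2 * Real.log α)))).add_const
    (Real.log (α * ε) / Real.log α)).smul_const z).add
    ((hI.const_mul (-(1 / Real.log α))).smul hB))
  have hD' := (hD.congr_of_eventuallyEq hev).fderiv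
  rw [hD']
  refine ContinuousLinearMap.opNorm_le_bound _ (by positivity) fun h => ?_
  have hi : |inner ℝ x h| ≤ ‖x‖ * ‖h‖ := abs_real_inner_le_norm x h
  have e1 := norm_crossB_le z x x
  have e2 := norm_crossB_le z x h
  have e3 := norm_crossB_le z h x
  have hval : ∀ D : EuclideanSpace ℝ (Fin 3) →L[ℝ] EuclideanSpace ℝ (Fin 3),
      D h = (-(1 / Real.log α) * (‖x‖ ^ 2)⁻¹ * inner ℝ x h) • z
        + ((2 / Real.log α) * ((‖x‖ ^ 2) ^ 2)⁻¹ * inner ℝ x h) • crossB z x x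
        + (-(1 / Real.log α) * (‖x‖ ^ 2)⁻¹) • (crossB z x h + crossB z h x) →
      ‖D h‖ ≤ 5 * ‖z‖ / (‖x‖ * Real.log α) * ‖h‖ := by
    intro D hDh
    rw [hDh]
    have b1 : ‖(-(1 / Real.log α) * (‖x‖ ^ 2)⁻¹ * inner ℝ x h) • z‖
        ≤ ‖z‖ / (‖x‖ * Real.log α) * ‖h‖ := by
      rw [norm_smul, norm_mul, norm_mul, norm_neg, Real.norm_of_nonneg (by positivity : 0 ≤ 1 / Real.log α),
        Real.norm_of_nonneg (by positivity : 0 ≤ (‖x‖ ^ 2)⁻¹), Real.norm_eq_abs]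
      calc _ ≤ 1 / Real.log α * (‖x‖ ^ 2)⁻¹ * (‖x‖ * ‖h‖) * ‖z‖ := by gcongr
        _ = _ := by field_simp
    have b2 : ‖((2 / Real.log α) * ((‖x‖ ^ 2) ^ 2)⁻¹ * inner ℝ x h) • crossB z x x‖
        ≤ 2 * (‖z‖ / (‖x‖ * Real.log α) * ‖h‖) := by
      rw [norm_smul, norm_mul, norm_mul, Real.norm_of_nonneg (by positivity : 0 ≤ 2 / Real.log α),
        Real.norm_of_nonneg (by positivity : 0 ≤ ((‖x‖ ^ 2) ^ 2)⁻¹), Real.norm_eq_abs]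
      calc _ ≤ 2 / Real.log α * ((‖x‖ ^ 2) ^ 2)⁻¹ * (‖x‖ * ‖h‖) * (‖z‖ * ‖x‖ * ‖x‖) := by gcongr
        _ = _ := by field_simp
    have b3 : ‖(-(1 / Real.log α) * (‖x‖ ^ 2)⁻¹) • (crossB z x h + crossB z h x)‖
        ≤ 2 * (‖z‖ / (‖x‖ * Real.log α) * ‖h‖) := by
      rw [norm_smul, norm_mul, norm_neg, Real.norm_of_nonneg (by positivity : 0 ≤ 1 / Real.log α),
        Real.norm_of_nonneg (by positivity : 0 ≤ (‖x‖ ^ 2)⁻¹)]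
      calc _ ≤ 1 / Real.log α * (‖x‖ ^ 2)⁻¹ * (‖z‖ * ‖x‖ * ‖h‖ + ‖z‖ * ‖h‖ * ‖x‖) := by
            gcongr
            exact (norm_add_le _ _).trans (add_le_add e2 e3)
        _ = _ := by field_simp; ring
    calc _ ≤ ‖z‖ / (‖x‖ * Real.log α) * ‖h‖ + 2 * (‖z‖ / (‖x‖ * Real.log α) * ‖h‖)
          + 2 * (‖z‖ / (‖x‖ * Real.log α) * ‖h‖) :=
          norm_add₃_le.trans (add_le_add (add_le_add b1 b2) b3)
      _ = _ := by ring
  apply hval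
  simp
  module

theorem integral_annulus (ε α : ℝ) (hε : 0 < ε) (hα : 1 < α) :
    (∫ x in {x : EuclideanSpace ℝ (Fin 3) | ε < ‖x‖ ∧ ‖x‖ < α * ε}, (‖x‖ ^ 3)⁻¹)
      = 4 * Real.pi * Real.log α := by
  have hm : MeasurableSet {x : EuclideanSpace ℝ (Fin 3) | ε < ‖x‖ ∧ ‖x‖ < α * ε} :=
    (measurableSet_lt measurable_const measurable_norm).inter
      (measurableSet_lt measurable_norm measurable_const)
  have hle : ε ≤ α * ε := by nlinarith
  rw [← integral_indicator hm]
  have := integral_fun_norm_addHaar (volume : Measure (EuclideanSpace ℝ (Fin 3)))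
    ((Set.Ioo ε (α * ε)).indicator fun r : ℝ => (r ^ 3)⁻¹)
  have e : (fun x : EuclideanSpace ℝ (Fin 3) => Set.indicator
      {x : EuclideanSpace ℝ (Fin 3) | ε < ‖x‖ ∧ ‖x‖ < α * ε} (fun x => (‖x‖ ^ 3)⁻¹) x)
      = fun x => (Set.Ioo ε (α * ε)).indicator (fun r : ℝ => (r ^ 3)⁻¹) ‖x‖ := by
    funext x; simp [Set.indicator]
  rw [e, this]
  have e2 : (∫ y in Set.Ioi (0:ℝ), y ^ (Module.finrank ℝ (EuclideanSpace ℝ (Fin 3)) - 1) •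
      (Set.Ioo ε (α * ε)).indicator (fun r : ℝ => (r ^ 3)⁻¹) y) = Real.log α := by
    have e3 : (fun y : ℝ => y ^ (Module.finrank ℝ (EuclideanSpace ℝ (Fin 3)) - 1) •
      (Set.Ioo ε (α * ε)).indicator (fun r : ℝ => (r ^ 3)⁻¹) y) =
      (Set.Ioo ε (α * ε)).indicator (fun r : ℝ => r⁻¹) := by
      funext y
      by_cases hy : y ∈ Set.Ioo ε (α * ε)
      · have : 0 < y := hε.trans hy.1
        simp [hy]
        field_simp
      · simp [hy]
    have e4 : Set.Ioi (0 : ℝ) ∩ Set.Ioo ε (α * ε) = Set.Ioo ε (α * ε) :=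
      Set.inter_eq_right.2 (fun y hy => hε.trans hy.1)
    rw [e3, setIntegral_indicator measurableSet_Ioo, e4, ← integral_Ioc_eq_integral_Ioo,
      ← intervalIntegral.integral_of_le hle, integral_inv_of_pos hε (by positivity)]
    congr 1
    field_simp
  rw [e2]
  have e5 : (volume : Measure (EuclideanSpace ℝ (Fin 3))).real (Metric.ball 0 1)
      = Real.pi * 4 / 3 := by
    rw [Measure.real, EuclideanSpace.volume_ball_fin_three, ENNReal.ofReal_one, one_pow, one_mul,
      ENNReal.toReal_ofReal (by positivity)]
  rw [e5]
  simp
  ring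

theorem integrableOn_annulus (ε α : ℝ) (hε : 0 < ε) :
    IntegrableOn (fun x : EuclideanSpace ℝ (Fin 3) => (‖x‖ ^ 3)⁻¹)
      {x : EuclideanSpace ℝ (Fin 3) | ε < ‖x‖ ∧ ‖x‖ < α * ε} := by
  have hK : IsCompact (Metric.closedBall (0 : EuclideanSpace ℝ (Fin 3)) (α * ε) ∩
      {x | ε ≤ ‖x‖}) :=
    (isCompact_closedBall _ _).inter_right (isClosed_le continuous_const continuous_norm)
  refine (ContinuousOn.integrableOn_compact hK ?_).mono_set ?_
  · refine ContinuousOn.inv₀ (by fun_prop) fun x hx => ?_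
    have : 0 < ‖x‖ := hε.trans_le hx.2
    positivity
  · intro x hx
    exact ⟨by simpa using hx.2.le, hx.1.le⟩

/-- `∫_{ε<|x|<αε} ‖DΨ_{ε,α}[z]‖³ dx ≤ 500π |z|³/(log α)²` in dimension 3. -/
theorem Psi3_deriv_L3_bound (ε α : ℝ) (hε : 0 < ε) (hα : 1 < α)
    (z : EuclideanSpace ℝ (Fin 3)) :
    (∫ x in {x : EuclideanSpace ℝ (Fin 3) | ε < ‖x‖ ∧ ‖x‖ < α * ε},
        ‖fderiv ℝ (Psi3 ε α z) x‖ ^ 3)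
      ≤ 500 * Real.pi * ‖z‖ ^ 3 / Real.log α ^ 2 := by
  have hL : 0 < Real.log α := Real.log_pos hα
  have hm : MeasurableSet {x : EuclideanSpace ℝ (Fin 3) | ε < ‖x‖ ∧ ‖x‖ < α * ε} :=
    (measurableSet_lt measurable_const measurable_norm).inter
      (measurableSet_lt measurable_norm measurable_const)
  calc _ ≤ ∫ x in {x : EuclideanSpace ℝ (Fin 3) | ε < ‖x‖ ∧ ‖x‖ < α * ε},
        (125 * ‖z‖ ^ 3 / Real.log α ^ 3) * (‖x‖ ^ 3)⁻¹ := by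
        refine integral_mono_of_nonneg (Filter.Eventually.of_forall fun x => by positivity)
          ((integrableOn_annulus ε α hε).const_mul _) ?_
        filter_upwards [ae_restrict_mem hm] with x hx
        have h := pow_le_pow_left₀ (norm_nonneg _)
          (norm_fderiv_Psi3_le ε α hε hα z x hx.1 hx.2) 3
        have hx0 : 0 < ‖x‖ := hε.trans hx.1
        refine h.trans (le_of_eq ?_)
        field_simp
        ring
    _ = _ := by
        rw [integral_const_mul, integral_annulus ε α hε hα]
        field_simp
        ring
end

section
/- There is a universal constant C > 0 (one may take C = 50π) such that for all ε > 0, α > 1 and z ∈ ℝ², ∫_{{x ∈ ℝ² : ε < |x| < αε}} ‖DΨ_{ε,α}[z](x)‖² dx ≤ C |z|² / log α, where DΨ denotes the Fréchet derivative of Ψ_{ε,α}[z] on the annulus and ‖·‖ the operator norm. -/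
open MeasureTheory

noncomputable def rotJ : EuclideanSpace ℝ (Fin 2) →L[ℝ] EuclideanSpace ℝ (Fin 2) :=
  LinearMap.toContinuousLinearMap
    { toFun := fun x => !₂[x 1, -x 0]
      map_add' := by
        intro x y
        ext i
        fin_cases i <;> simp
        ring
      map_smul' := by
        intro c x
        ext i
        fin_cases i <;> simp }

theorem rotJ_apply (x : EuclideanSpace ℝ (Fin 2)) : rotJ x = !₂[x 1, -x 0] := rfl

theorem norm_rotJ (x : EuclideanSpace ℝ (Fin 2)) : ‖rotJ x‖ = ‖x‖ := by
  rw [rotJ_apply, EuclideanSpace.norm_eq, EuclideanSpace.norm_eq]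
  simp [Fin.sum_univ_two, add_comm]

theorem gz_eq (z x : EuclideanSpace ℝ (Fin 2)) : gz z x = innerSL ℝ (rotJ z) x := by
  simp [gz, rotJ_apply, PiLp.inner_apply, Fin.sum_univ_two]
  ring

theorem Psi2_eq (ε α : ℝ) (hε : 0 < ε) (hα : 1 < α) (z x : EuclideanSpace ℝ (Fin 2))
    (h1 : ε < ‖x‖) (h2 : ‖x‖ < α * ε) :
    Psi2 ε α z x = ((Real.log (α * ε) - Real.log (‖x‖ ^ 2) / 2) * (Real.log α)⁻¹) • z
      + (innerSL ℝ (rotJ z) x * ((‖x‖ ^ 2)⁻¹ * (Real.log α)⁻¹)) • rotJ x := by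
  have hL : 0 < Real.log α := Real.log_pos hα
  have e1 : eta 2 ε α x = (Real.log (α * ε) - Real.log (‖x‖ ^ 2) / 2) * (Real.log α)⁻¹ := by
    rw [eta, fAB, if_neg (not_lt.2 h1.le), if_pos h2.le,
      Real.log_mul (by positivity) (by positivity), Real.log_pow]
    field_simp
    have : Real.log ε - (Real.log α + Real.log ε) = - Real.log α := by ring
    rw [this]
    field_simp
    push_cast
    ring
  have e2 : perpGradEta2 α x = ((‖x‖ ^ 2)⁻¹ * (Real.log α)⁻¹) • rotJ x := by
    rw [perpGradEta2, rotJ_apply]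
    ext i
    fin_cases i <;> simp [div_eq_mul_inv] <;> ring
  rw [Psi2, if_neg (not_le.2 h1), if_pos h2, e1, e2, gz_eq, smul_smul]

theorem Psi2_fderiv_bound (ε α : ℝ) (hε : 0 < ε) (hα : 1 < α) (z x : EuclideanSpace ℝ (Fin 2))
    (h1 : ε < ‖x‖) (h2 : ‖x‖ < α * ε) :
    ‖fderiv ℝ (Psi2 ε α z) x‖ ≤ 5 * ‖z‖ / (‖x‖ * Real.log α) := by
  have hL : 0 < Real.log α := Real.log_pos hα
  have hx : 0 < ‖x‖ := hε.trans h1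
  have hx2 : ‖x‖ ^ 2 ≠ 0 := by positivity
  have hq : HasFDerivAt (fun y : EuclideanSpace ℝ (Fin 2) => ‖y‖ ^ 2) (2 • innerSL ℝ x) x :=
    (hasStrictFDerivAt_norm_sq x).hasFDerivAt
  have hA := ((((hq.log hx2).mul_const (2 : ℝ)⁻¹).const_sub (Real.log (α * ε))).mul_const
    (Real.log α)⁻¹).smul_const z
  have hB := ((innerSL ℝ (rotJ z)).hasFDerivAt (x := x)).mul
    ((((hasDerivAt_inv hx2).comp_hasFDerivAt x hq)).mul_const (Real.log α)⁻¹)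
  have hC := hA.add (hB.smul (rotJ.hasFDerivAt (x := x)))
  have hev : Psi2 ε α z =ᶠ[nhds x] fun x =>
      ((Real.log (α * ε) - Real.log (‖x‖ ^ 2) * (2 : ℝ)⁻¹) * (Real.log α)⁻¹) • z
      + (innerSL ℝ (rotJ z) x * ((‖x‖ ^ 2)⁻¹ * (Real.log α)⁻¹)) • rotJ x := by
    have o1 : ∀ᶠ y in nhds x, ε < ‖y‖ := continuous_norm.continuousAt.eventually_const_lt h1
    have o2 : ∀ᶠ y in nhds x, ‖y‖ < α * ε := continuous_norm.continuousAt.eventually_lt_const h2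
    filter_upwards [o1, o2] with y hy1 hy2
    rw [Psi2_eq ε α hε hα z y hy1 hy2]
    rfl
  have hD := hC.congr_of_eventuallyEq hev
  rw [hD.fderiv]
  refine ContinuousLinearMap.opNorm_le_bound _ (by positivity) fun v => ?_
  set L := Real.log α
  have hi : ∀ a b : EuclideanSpace ℝ (Fin 2), |inner ℝ a b| ≤ ‖a‖ * ‖b‖ :=
    fun a b => abs_real_inner_le_norm a b
  have hv := hi x v
  have hzx := hi (rotJ z) x
  have hzv := hi (rotJ z) v
  rw [norm_rotJ] at hzx hzv
  have key : ∀ w, w = (-(inner ℝ x v) / (‖x‖ ^ 2 * L)) • z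
      + (inner ℝ (rotJ z) v / (‖x‖ ^ 2 * L)) • rotJ x
      + (inner ℝ (rotJ z) x / (‖x‖ ^ 2 * L)) • rotJ v
      + (-2 * inner ℝ (rotJ z) x * inner ℝ x v / (‖x‖ ^ 4 * L)) • rotJ x →
      ‖w‖ ≤ 5 * ‖z‖ / (‖x‖ * L) * ‖v‖ := by
    rintro w rfl
    refine (norm_add_le _ _).trans ?_
    refine (add_le_add_left (norm_add_le _ _) _).trans ?_
    refine (add_le_add_left (add_le_add_left (norm_add_le _ _) _) _).trans ?_
    simp only [norm_smul, norm_rotJ, norm_div, norm_mul, norm_neg, Real.norm_eq_abs, abs_pow,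
      abs_norm, abs_of_pos hL, abs_two]
    calc _ ≤ (‖x‖ * ‖v‖) / (‖x‖ ^ 2 * L) * ‖z‖ + (‖z‖ * ‖v‖) / (‖x‖ ^ 2 * L) * ‖x‖
          + (‖z‖ * ‖x‖) / (‖x‖ ^ 2 * L) * ‖v‖
          + 2 * (‖z‖ * ‖x‖) * (‖x‖ * ‖v‖) / (‖x‖ ^ 4 * L) * ‖x‖ := by gcongr
      _ = _ := by field_simp; ring
  apply key
  simp
  module

theorem annulus_integral (ε α : ℝ) (hε : 0 < ε) (hα : 1 < α) :
    IntegrableOn (fun x : EuclideanSpace ℝ (Fin 2) => (‖x‖ ^ 2)⁻¹)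
      {x : EuclideanSpace ℝ (Fin 2) | ε < ‖x‖ ∧ ‖x‖ < α * ε} ∧
    ∫ x in {x : EuclideanSpace ℝ (Fin 2) | ε < ‖x‖ ∧ ‖x‖ < α * ε}, (‖x‖ ^ 2)⁻¹
      = 2 * Real.pi * Real.log α := by
  have hle : ε ≤ α * ε := by nlinarith
  have hm : MeasurableSet {x : EuclideanSpace ℝ (Fin 2) | ε < ‖x‖ ∧ ‖x‖ < α * ε} :=
    (measurableSet_lt measurable_const measurable_norm).inter
      (measurableSet_lt measurable_norm measurable_const)
  have hind : (Set.indicator {x : EuclideanSpace ℝ (Fin 2) | ε < ‖x‖ ∧ ‖x‖ < α * ε}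
      fun x => (‖x‖ ^ 2)⁻¹) = fun x => (Set.Ioo ε (α * ε)).indicator (fun r => (r ^ 2)⁻¹) ‖x‖ := by
    ext x
    simp [Set.indicator]
  have hsub : Set.Ioo ε (α * ε) ∩ Set.Ioi 0 = Set.Ioo ε (α * ε) := by
    apply Set.inter_eq_left.2
    intro r hr
    exact hε.trans hr.1
  have heq : (fun y : ℝ => y ^ 1 • (Set.Ioo ε (α * ε)).indicator (fun r => (r ^ 2)⁻¹) y)
      = (Set.Ioo ε (α * ε)).indicator (fun r => r⁻¹) := by
    ext y
    by_cases hy : y ∈ Set.Ioo ε (α * ε)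
    · have : 0 < y := hε.trans hy.1
      simp [hy]
      field_simp
    · simp [hy]
  have hint : IntegrableOn (fun r : ℝ => r⁻¹) (Set.Ioo ε (α * ε)) := by
    have : IntegrableOn (fun r : ℝ => r⁻¹) (Set.Icc ε (α * ε)) := by
      apply ContinuousOn.integrableOn_Icc
      apply continuousOn_inv₀.mono
      intro r hr
      exact (hε.trans_le hr.1).ne'
    exact this.mono_set Set.Ioo_subset_Icc_self
  constructor
  · rw [← integrable_indicator_iff hm, hind, integrable_fun_norm_addHaar]
    simp only [finrank_euclideanSpace, Fintype.card_fin, Nat.add_one_sub_one]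
    rw [heq]
    exact ((integrable_indicator_iff measurableSet_Ioo).2 hint).integrableOn
  · rw [← integral_indicator hm, hind, integral_fun_norm_addHaar]
    simp only [finrank_euclideanSpace, Fintype.card_fin, Nat.add_one_sub_one]
    rw [heq, setIntegral_indicator measurableSet_Ioo, Set.inter_comm, hsub,
      ← integral_Ioc_eq_integral_Ioo, ← intervalIntegral.integral_of_le hle,
      integral_inv_of_pos hε (by positivity), mul_div_cancel_right₀ _ hε.ne', Measure.real,
      EuclideanSpace.volume_ball_fin_two]
    simp [mul_assoc, Real.pi_pos.le]

/-- `∫_{ε<|x|<αε} ‖DΨ_{ε,α}[z]‖² dx ≤ 50π |z|²/log α` in dimension 2. -/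
theorem Psi2_deriv_L2_bound (ε α : ℝ) (hε : 0 < ε) (hα : 1 < α)
    (z : EuclideanSpace ℝ (Fin 2)) :
    (∫ x in {x : EuclideanSpace ℝ (Fin 2) | ε < ‖x‖ ∧ ‖x‖ < α * ε},
        ‖fderiv ℝ (Psi2 ε α z) x‖ ^ 2)
      ≤ 50 * Real.pi * ‖z‖ ^ 2 / Real.log α := by
  have hL : 0 < Real.log α := Real.log_pos hα
  obtain ⟨hI, hE⟩ := annulus_integral ε α hε hα
  have hm : MeasurableSet {x : EuclideanSpace ℝ (Fin 2) | ε < ‖x‖ ∧ ‖x‖ < α * ε} :=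
    (measurableSet_lt measurable_const measurable_norm).inter
      (measurableSet_lt measurable_norm measurable_const)
  calc _ ≤ ∫ x in {x : EuclideanSpace ℝ (Fin 2) | ε < ‖x‖ ∧ ‖x‖ < α * ε},
        (5 * ‖z‖ / Real.log α) ^ 2 * (‖x‖ ^ 2)⁻¹ := by
        apply integral_mono_of_nonneg
        · exact Filter.Eventually.of_forall fun x => by positivity
        · exact hI.const_mul _
        · filter_upwards [ae_restrict_mem hm] with x hx
          have hx0 : 0 < ‖x‖ := hε.trans hx.1
          refine (pow_le_pow_left₀ (norm_nonneg _)
            (Psi2_fderiv_bound ε α hε hα z x hx.1 hx.2) 2).trans_eq ?_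
          field_simp
    _ = _ := by
        rw [integral_const_mul, hE]
        field_simp
        ring
end

section
/- Let d ≥ 1 be an integer and let u ∈ C_c^∞(ℝ^d; ℝ^d) be a smooth compactly supported vector field. Then 2 ∫_{ℝ^d} |D(u)(x)|² dx = ∫_{ℝ^d} |∇u(x)|² dx + ∫_{ℝ^d} (div u(x))² dx, where D(u) = (∇u + (∇u)ᵀ)/2 is the symmetric gradient and |·| denotes the Frobenius norm of a matrix. In particular (Korn inequality on the whole space) ∫_{ℝ^d} |∇u|² dx ≤ 2 ∫_{ℝ^d} |D(u)|² dx. -/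
open MeasureTheory

/-- The Jacobian entry `∂_j u_i (x)` of a vector field `u : ℝ^d → ℝ^d`. -/
noncomputable def jac {d : ℕ} (u : EuclideanSpace ℝ (Fin d) → EuclideanSpace ℝ (Fin d))
    (x : EuclideanSpace ℝ (Fin d)) (i j : Fin d) : ℝ :=
  fderiv ℝ u x (EuclideanSpace.single j 1) i

lemma korn_smooth {E : Type*} [NormedAddCommGroup E] [NormedSpace ℝ E]
    {f : E → ℝ} (hf : ContDiff ℝ (⊤ : ℕ∞) f) (a : E) :
    ContDiff ℝ (⊤ : ℕ∞) (fun x => fderiv ℝ f x a) :=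
  (hf.fderiv_right (m := (⊤ : ℕ∞)) (by simp)).clm_apply contDiff_const

lemma korn_supp {E : Type*} [NormedAddCommGroup E] [NormedSpace ℝ E]
    {f : E → ℝ} (hf : HasCompactSupport f) (a : E) :
    HasCompactSupport (fun x => fderiv ℝ f x a) :=
  hf.fderiv_apply ℝ a

lemma korn_swap {d : ℕ} {f g : EuclideanSpace ℝ (Fin d) → ℝ}
    (hf : ContDiff ℝ (⊤ : ℕ∞) f) (hfc : HasCompactSupport f)
    (hg : ContDiff ℝ (⊤ : ℕ∞) g) (a b : EuclideanSpace ℝ (Fin d)) :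
    ∫ x, fderiv ℝ f x a * fderiv ℝ g x b = ∫ x, fderiv ℝ f x b * fderiv ℝ g x a := by
  have key : ∀ a b : EuclideanSpace ℝ (Fin d),
      ∫ x, fderiv ℝ f x a * fderiv ℝ g x b
        = - ∫ x, fderiv ℝ (fun y => fderiv ℝ f y a) x b * g x := by
    intro a b
    have h1 := korn_smooth hf a
    have h1c := korn_supp hfc a
    have h2 := korn_smooth h1 b
    have h2c := korn_supp h1c b
    have h3 := korn_smooth hg b
    refine integral_mul_fderiv_eq_neg_fderiv_mul_of_integrable ?_ ?_ ?_ ?_ ?_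
    · exact (h2.continuous.mul hg.continuous).integrable_of_hasCompactSupport h2c.mul_right
    · exact (h1.continuous.mul h3.continuous).integrable_of_hasCompactSupport h1c.mul_right
    · exact (h1.continuous.mul hg.continuous).integrable_of_hasCompactSupport h1c.mul_right
    · exact fun x _ => (h1.differentiable (by simp)) x
    · exact fun x _ => (hg.differentiable (by simp)) x
  rw [key a b, key b a]
  congr 2
  ext x
  congr 1
  have hd : DifferentiableAt ℝ (fderiv ℝ f) x :=
    (hf.fderiv_right (m := (⊤ : ℕ∞)) (by simp)).differentiable (by simp) x
  have e : ∀ a b, fderiv ℝ (fun y => fderiv ℝ f y a) x b = fderiv ℝ (fderiv ℝ f) x b a := by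
    intro a b
    rw [fderiv_clm_apply hd (differentiableAt_const a)]
    simp
  rw [e, e]
  exact (hf.contDiffAt.isSymmSndFDerivAt (by simp; exact WithTop.coe_le_coe.2 (le_top : (2 : ℕ∞) ≤ ⊤))) b a

/-- For a smooth compactly supported vector field `u` on `ℝ^d`,
`2∫|D(u)|² = ∫|∇u|² + ∫(div u)²` (Frobenius norms), and in particular the Korn
inequality `∫|∇u|² ≤ 2∫|D(u)|²` holds on the whole space. -/
theorem korn_identity (d : ℕ) (hd : 1 ≤ d)
    (u : EuclideanSpace ℝ (Fin d) → EuclideanSpace ℝ (Fin d))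
    (hu : ContDiff ℝ (⊤ : ℕ∞) u) (hc : HasCompactSupport u) :
    (2 * ∫ x, ∑ i, ∑ j, ((jac u x i j + jac u x j i) / 2) ^ 2
      = (∫ x, ∑ i, ∑ j, jac u x i j ^ 2) + ∫ x, (∑ i, jac u x i i) ^ 2) ∧
    (∫ x, ∑ i, ∑ j, jac u x i j ^ 2)
      ≤ 2 * ∫ x, ∑ i, ∑ j, ((jac u x i j + jac u x j i) / 2) ^ 2 := by
  have hus : ∀ i, ContDiff ℝ (⊤ : ℕ∞) (fun x => u x i) := contDiff_euclidean.1 hu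
  have huc : ∀ i, HasCompactSupport (fun x => u x i) := fun i =>
    hc.comp_left (g := fun v : EuclideanSpace ℝ (Fin d) => v i) (by simp)
  have hj : ∀ i j x, jac u x i j = fderiv ℝ (fun y => u y i) x (EuclideanSpace.single j 1) := by
    intro i j x
    have h := (EuclideanSpace.proj i : EuclideanSpace ℝ (Fin d) →L[ℝ] ℝ).hasFDerivAt.comp x
      ((hu.differentiable (by simp)) x).hasFDerivAt
    have h' : HasFDerivAt (fun y => u y i) _ x := h
    rw [h'.fderiv]
    rfl
  have hcont : ∀ i j, Continuous (fun x => jac u x i j) := by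
    intro i j
    simp only [hj]
    exact (korn_smooth (hus i) _).continuous
  have hsupp : ∀ i j, HasCompactSupport (fun x => jac u x i j) := by
    intro i j
    simp only [hj]
    exact korn_supp (huc i) _
  have hint : ∀ i j k l, Integrable (fun x => jac u x i j * jac u x k l) := fun i j k l =>
    ((hcont i j).mul (hcont k l)).integrable_of_hasCompactSupport (hsupp i j).mul_right
  have hswap : ∀ i j, ∫ x, jac u x i j * jac u x j i = ∫ x, jac u x i i * jac u x j j := by
    intro i j
    simp only [hj]
    exact korn_swap (hus i) (huc i) (hus j) _ _
  have hI : ∀ (F G : EuclideanSpace ℝ (Fin d) → Fin d → Fin d → ℝ),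
      (∀ i j, Integrable (fun x => F x i j * G x i j)) →
      ∫ x, ∑ i, ∑ j, F x i j * G x i j = ∑ i, ∑ j, ∫ x, F x i j * G x i j := by
    intro F G h
    rw [integral_finsetSum _ (fun i _ => integrable_finsetSum _ (fun j _ => h i j))]
    exact Finset.sum_congr rfl fun i _ => integral_finsetSum _ (fun j _ => h i j)
  have hdiv : ∫ x, (∑ i, jac u x i i) ^ 2 = ∫ x, ∑ i, ∑ j, jac u x i j * jac u x j i := by
    simp only [sq, Finset.sum_mul_sum]
    rw [hI (fun x i _ => jac u x i i) (fun x _ j => jac u x j j) (fun i j => hint _ _ _ _),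
      hI (fun x i j => jac u x i j) (fun x i j => jac u x j i) (fun i j => hint _ _ _ _)]
    simp only [hswap]
  have hpt : ∀ x, 2 * ∑ i, ∑ j, ((jac u x i j + jac u x j i) / 2) ^ 2
      = ∑ i, ∑ j, jac u x i j ^ 2 + ∑ i, ∑ j, jac u x i j * jac u x j i := by
    intro x
    have e : ∑ i, ∑ j, jac u x j i ^ 2 = ∑ i, ∑ j, jac u x i j ^ 2 := Finset.sum_comm
    have e2 : 2 * ∑ i, ∑ j, ((jac u x i j + jac u x j i) / 2) ^ 2
        = (1 / 2) * ∑ i, ∑ j, jac u x i j ^ 2 + (1 / 2) * ∑ i, ∑ j, jac u x j i ^ 2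
          + ∑ i, ∑ j, jac u x i j * jac u x j i := by
      simp only [Finset.mul_sum, ← Finset.sum_add_distrib]
      refine Finset.sum_congr rfl fun i _ => Finset.sum_congr rfl fun j _ => ?_
      ring
    rw [e2, e]
    ring
  have main : 2 * ∫ x, ∑ i, ∑ j, ((jac u x i j + jac u x j i) / 2) ^ 2
      = (∫ x, ∑ i, ∑ j, jac u x i j ^ 2) + ∫ x, (∑ i, jac u x i i) ^ 2 := by
    rw [hdiv, ← integral_const_mul, ← integral_add]
    · simp only [hpt]
    · simp only [sq]
      exact integrable_finsetSum _ fun i _ => integrable_finsetSum _ fun j _ => hint _ _ _ _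
    · exact integrable_finsetSum _ fun i _ => integrable_finsetSum _ fun j _ => hint _ _ _ _
  refine ⟨main, ?_⟩
  rw [main]
  exact le_add_of_nonneg_right (integral_nonneg fun x => sq_nonneg _)
end
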